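/- arXiv:2405.10549 — 2 statements merged into one kernel-verified Lean document; each statement's English description precedes it below -/
import Mathlib

section
/- Let m > 0, N ∈ ℤ, let F : (0,∞) → ℝ be continuously differentiable, let f : (0,∞) → ℂ be smooth and compactly supported in (0,∞), let ℓ₁, ℓ₂ ∈ ℤ, t ∈ {1,−1}, and let u_t ∈ ℂ² be a unit vector with τ₃ u_t = t u_t. Define Ψ(r,φ) := (1/(2√π)) ( f(r) e^{i ℓ₁ φ} (e₁ ⊗ u_t) + f(r) e^{i ℓ₂ φ} (e₂ ⊗ u_t) ) ∈ ℂ⁴, where e₁ = (1,0), e₂ = (0,1) ∈ ℂ². Then ∫₀^∞ ∫₀^{2π} ⟨ Ψ(r,φ), Ṽ(r,φ) Ψ(r,φ) ⟩_{ℂ⁴} dφ · r dr = m t δ_{ℓ₁+1, ℓ₂} · ∫₀^∞ F'(r) sin(F(r)) |f(r)|² r dr, where δ_{ℓ₁+1, ℓ₂} equals 1 if ℓ₂ = ℓ₁ + 1 and 0 otherwise. -/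
open MeasureTheory Matrix

noncomputable section

/-- The Pauli matrices `τ₁, τ₂, τ₃`. -/
def τ1 : Matrix (Fin 2) (Fin 2) ℂ := !![0, 1; 1, 0]
def τ2 : Matrix (Fin 2) (Fin 2) ℂ := !![0, -Complex.I; Complex.I, 0]
def τ3 : Matrix (Fin 2) (Fin 2) ℂ := !![1, 0; 0, -1]

def τ : Fin 3 → Matrix (Fin 2) (Fin 2) ℂ := ![τ1, τ2, τ3]

/-- For the hedgehog ansatz `ñ` with profile `F` and invariant `N`, the matrix
`W̃(r,φ) = −m e^{iφ} Σⱼ (∂ñⱼ/∂r + (i/r) ∂ñⱼ/∂φ) τⱼ`. -/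
def Wt (m : ℝ) (ntilde : Fin 3 → ℝ → ℝ → ℝ) (r φ : ℝ) : Matrix (Fin 2) (Fin 2) ℂ :=
  (-(m : ℂ) * Complex.exp (Complex.I * φ)) •
    ∑ j : Fin 3,
      (((deriv (fun s => ntilde j s φ) r : ℝ) : ℂ)
        + Complex.I * (1 / (r : ℂ)) * ((deriv (fun ϑ => ntilde j r ϑ) φ : ℝ) : ℂ)) • τ j

/-- The potential `Ṽ(r,φ) = [[0, W̃(r,φ)*], [W̃(r,φ), 0]]` in 2×2 blocks, the block
index being the first Kronecker factor. -/
def Vt (m : ℝ) (ntilde : Fin 3 → ℝ → ℝ → ℝ) (r φ : ℝ) :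
    Matrix (Fin 2 × Fin 2) (Fin 2 × Fin 2) ℂ := fun p q =>
  if p.1 = 0 then (if q.1 = 0 then 0 else (Wt m ntilde r φ)ᴴ p.2 q.2)
  else (if q.1 = 0 then Wt m ntilde r φ p.2 q.2 else 0)

/-- A spin-polarized vector only sees the third component of a combination of Pauli matrices. -/
lemma sum_star_mul_pauli_mulVec {t : ℝ} (ht : t = 1 ∨ t = -1) {u : Fin 2 → ℂ}
    (hu : ‖u 0‖ ^ 2 + ‖u 1‖ ^ 2 = 1) (hut : τ3 *ᵥ u = (t : ℂ) • u) (c : Fin 3 → ℂ) :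
    ∑ i : Fin 2, ∑ j : Fin 2,
      (starRingEnd ℂ) (u i) * (∑ k : Fin 3, c k • τ k) i j * u j = c 2 * t := by
  have h0 := congrFun hut 0
  have h1 := congrFun hut 1
  simp [τ3, mulVec, dotProduct, Fin.sum_univ_two] at h0 h1
  rcases ht with rfl | rfl
  · have hu1 : u 1 = 0 := by
      push_cast at h1
      linear_combination (-1 / 2 : ℂ) * h1
    have hn : (starRingEnd ℂ) (u 0) * u 0 = 1 := by
      rw [Complex.conj_mul']
      simp only [hu1, norm_zero] at hu
      norm_cast
      linarith
    simp [Fin.sum_univ_two, Fin.sum_univ_three, τ, τ1, τ2, τ3, hu1]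
    linear_combination c 2 * hn
  · have hu0 : u 0 = 0 := by
      push_cast at h0
      linear_combination (1 / 2 : ℂ) * h0
    have hn : (starRingEnd ℂ) (u 1) * u 1 = 1 := by
      rw [Complex.conj_mul']
      simp only [hu0, norm_zero] at hu
      norm_cast
      linarith
    simp [Fin.sum_univ_two, Fin.sum_univ_three, τ, τ1, τ2, τ3, hu0]
    linear_combination c 2 * hn

lemma integral_exp_int_mul (k : ℤ) :
    ∫ φ in (0 : ℝ)..(2 * Real.pi), Complex.exp (Complex.I * k * φ) =
      if k = 0 then (2 * Real.pi : ℂ) else 0 := by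
  split_ifs with h
  · simp [h]
  · have hk : Complex.I * (k : ℂ) ≠ 0 := by simp [h]
    rw [integral_exp_mul_complex hk]
    have : Complex.exp (Complex.I * k * ((2 * Real.pi : ℝ) : ℂ)) = 1 := by
      rw [← Complex.exp_int_mul_two_pi_mul_I k]
      congr 1
      push_cast
      ring
    rw [this]
    simp

/-- For `Ψ(r,φ) = (1/(2√π))( f(r) e^{iℓ₁φ} (e₁ ⊗ u_t) + f(r) e^{iℓ₂φ} (e₂ ⊗ u_t) )`,
`∫₀^∞ ∫₀^{2π} ⟨Ψ, Ṽ Ψ⟩ dφ · r dr = m t δ_{ℓ₁+1,ℓ₂} ∫₀^∞ F'(r) sin(F(r)) |f(r)|² r dr`. -/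
theorem stmt_7 (m : ℝ) (hm : 0 < m) (N : ℤ)
    (F : ℝ → ℝ) (hF : ContDiffOn ℝ 1 F (Set.Ioi 0))
    (f : ℝ → ℂ) (hf : ContDiff ℝ (⊤ : ℕ∞) f) (hfc : HasCompactSupport f)
    (hfsupp : tsupport f ⊆ Set.Ioi 0)
    (ℓ₁ ℓ₂ : ℤ) (t : ℝ) (ht : t = 1 ∨ t = -1)
    (u : Fin 2 → ℂ) (hu : ‖u 0‖ ^ 2 + ‖u 1‖ ^ 2 = 1)
    (hut : τ3 *ᵥ u = (t : ℂ) • u)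
    (ntilde : Fin 3 → ℝ → ℝ → ℝ)
    (hn1 : ∀ r φ, ntilde 0 r φ = Real.sin (F r) * Real.cos (N * φ))
    (hn2 : ∀ r φ, ntilde 1 r φ = Real.sin (F r) * Real.sin (N * φ))
    (hn3 : ∀ r φ, ntilde 2 r φ = Real.cos (F r))
    (Ψ : ℝ → ℝ → (Fin 2 × Fin 2) → ℂ)
    (hΨ : ∀ r φ p, Ψ r φ p =
      (1 / (2 * Real.sqrt Real.pi) : ℂ) *
        (f r * Complex.exp (Complex.I * ℓ₁ * φ) * (if p.1 = 0 then u p.2 else 0)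
          + f r * Complex.exp (Complex.I * ℓ₂ * φ) * (if p.1 = 1 then u p.2 else 0))) :
    (∫ r in Set.Ioi (0 : ℝ),
        (∫ φ in (0 : ℝ)..(2 * Real.pi),
          ∑ p : Fin 2 × Fin 2,
            (starRingEnd ℂ) (Ψ r φ p) * ((Vt m ntilde r φ *ᵥ Ψ r φ) p))
          * (r : ℂ))
      = ((m * t : ℝ) : ℂ) * (if ℓ₂ = ℓ₁ + 1 then 1 else 0)
          * ((∫ r in Set.Ioi (0 : ℝ),
                deriv F r * Real.sin (F r) * ‖f r‖ ^ 2 * r : ℝ) : ℂ) := by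
  have key : ∀ r ∈ Set.Ioi (0 : ℝ), ∀ φ : ℝ,
      ∑ p : Fin 2 × Fin 2, (starRingEnd ℂ) (Ψ r φ p) * ((Vt m ntilde r φ *ᵥ Ψ r φ) p)
        = ((m * t * (deriv F r * Real.sin (F r) * ‖f r‖ ^ 2) / (4 * Real.pi) : ℝ) : ℂ)
          * (Complex.exp (Complex.I * ((ℓ₁ + 1 - ℓ₂ : ℤ) : ℂ) * φ)
            + Complex.exp (Complex.I * ((-(ℓ₁ + 1 - ℓ₂) : ℤ) : ℂ) * φ)) := by
    intro r hr φ
    have hFd : DifferentiableAt ℝ F r :=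
      (hF.differentiableOn one_ne_zero).differentiableAt (Ioi_mem_nhds hr)
    have hdr : deriv (fun s => ntilde 2 s φ) r = -(deriv F r * Real.sin (F r)) := by
      simp only [hn3]
      rw [deriv_cos hFd]
      ring
    have hdφ : deriv (fun ϑ => ntilde 2 r ϑ) φ = 0 := by simp [hn3]
    set w : ℂ := Complex.exp (Complex.I * φ) * (m * t * (deriv F r * Real.sin (F r)) : ℝ) with hw
    have hW : ∑ i : Fin 2, ∑ j : Fin 2,
        (starRingEnd ℂ) (u i) * Wt m ntilde r φ i j * u j = w := by
      have h := sum_star_mul_pauli_mulVec ht hu hut fun j =>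
        (((deriv (fun s => ntilde j s φ) r : ℝ) : ℂ)
          + Complex.I * (1 / (r : ℂ)) * ((deriv (fun ϑ => ntilde j r ϑ) φ : ℝ) : ℂ))
      rw [hdr, hdφ] at h
      simp only [Wt, Matrix.smul_apply, smul_eq_mul]
      simp only [Fin.sum_univ_two] at h ⊢
      push_cast at h
      rw [hw]
      push_cast
      linear_combination (-(m : ℂ) * Complex.exp (Complex.I * φ)) * h
    have hW' : ∑ i : Fin 2, ∑ j : Fin 2,
        (starRingEnd ℂ) (u i) * (Wt m ntilde r φ)ᴴ i j * u j = (starRingEnd ℂ) w := by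
      rw [← hW]
      simp only [Fin.sum_univ_two, conjTranspose_apply, map_add, map_mul, RCLike.star_def,
        Complex.conj_conj]
      ring
    have hc : ∀ k : ℤ, (starRingEnd ℂ) (Complex.exp (Complex.I * k * φ))
        = Complex.exp (-(Complex.I * k * φ)) := by
      intro k
      rw [← Complex.exp_conj]
      simp
    have hcw : (starRingEnd ℂ) w =
        Complex.exp (-(Complex.I * φ)) * (m * t * (deriv F r * Real.sin (F r)) : ℝ) := by
      rw [hw, map_mul, Complex.conj_ofReal, ← Complex.exp_conj]
      simp
    have hpi : ((1 / (2 * Real.sqrt Real.pi) : ℂ)) ^ 2 = 1 / (4 * Real.pi) := by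
      have : ((Real.sqrt Real.pi : ℝ) : ℂ) ^ 2 = Real.pi := by
        norm_cast
        exact Real.sq_sqrt Real.pi_pos.le
      rw [div_pow, mul_pow, this]
      norm_num
    have hcpi : (starRingEnd ℂ) (1 / (2 * Real.sqrt Real.pi) : ℂ)
        = 1 / (2 * Real.sqrt Real.pi) := by
      rw [map_div₀, map_mul, map_one, Complex.conj_ofReal, map_ofNat]
    have hff : (starRingEnd ℂ) (f r) * f r = (‖f r‖ : ℂ) ^ 2 := Complex.conj_mul' _
    have e1 : Complex.exp (Complex.I * ((ℓ₁ + 1 - ℓ₂ : ℤ) : ℂ) * φ)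
        = Complex.exp (-(Complex.I * ℓ₂ * φ)) * Complex.exp (Complex.I * ℓ₁ * φ)
          * Complex.exp (Complex.I * φ) := by
      rw [← Complex.exp_add, ← Complex.exp_add]
      congr 1
      push_cast
      ring
    have e2 : Complex.exp (Complex.I * ((-(ℓ₁ + 1 - ℓ₂) : ℤ) : ℂ) * φ)
        = Complex.exp (-(Complex.I * ℓ₁ * φ)) * Complex.exp (Complex.I * ℓ₂ * φ)
          * Complex.exp (-(Complex.I * φ)) := by
      rw [← Complex.exp_add, ← Complex.exp_add]
      congr 1
      push_cast
      ring
    have expand : ∑ p : Fin 2 × Fin 2,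
          (starRingEnd ℂ) (Ψ r φ p) * ((Vt m ntilde r φ *ᵥ Ψ r φ) p)
        = (1 / (2 * Real.sqrt Real.pi) : ℂ) ^ 2 * ((starRingEnd ℂ) (f r) * f r) *
          (Complex.exp (-(Complex.I * ℓ₂ * φ)) * Complex.exp (Complex.I * ℓ₁ * φ) * w
            + Complex.exp (-(Complex.I * ℓ₁ * φ)) * Complex.exp (Complex.I * ℓ₂ * φ)
              * (starRingEnd ℂ) w) := by
      rw [← hW', ← hW]
      simp only [mulVec, dotProduct, Fintype.sum_prod_type, Fin.sum_univ_two, Vt, hΨ, map_mul,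
        map_add, hc, hcpi]
      simp only [Fin.isValue, if_true, one_ne_zero, zero_ne_one, if_false, map_zero]
      ring
    rw [expand, hcw, hw, hpi, hff, e1, e2]
    push_cast
    ring
  have inner : ∀ r ∈ Set.Ioi (0 : ℝ),
      (∫ φ in (0 : ℝ)..(2 * Real.pi), ∑ p : Fin 2 × Fin 2,
          (starRingEnd ℂ) (Ψ r φ p) * ((Vt m ntilde r φ *ᵥ Ψ r φ) p)) * (r : ℂ)
        = ((m * t : ℝ) : ℂ) * (if ℓ₂ = ℓ₁ + 1 then 1 else 0)
          * ((deriv F r * Real.sin (F r) * ‖f r‖ ^ 2 * r : ℝ) : ℂ) := by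
    intro r hr
    have hint : ∀ k : ℤ, IntervalIntegrable (fun φ : ℝ => Complex.exp (Complex.I * k * φ))
        volume 0 (2 * Real.pi) := fun k =>
      (by fun_prop : Continuous fun φ : ℝ => Complex.exp (Complex.I * k * φ)).intervalIntegrable _ _
    simp only [key r hr]
    rw [intervalIntegral.integral_const_mul, intervalIntegral.integral_add (hint _) (hint _),
      integral_exp_int_mul, integral_exp_int_mul]
    have hpi : (Real.pi : ℂ) ≠ 0 := by exact_mod_cast Real.pi_ne_zero
    by_cases h : ℓ₂ = ℓ₁ + 1
    · rw [if_pos (by lia), if_pos (by lia), if_pos h]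
      push_cast
      field_simp
      ring
    · rw [if_neg (by lia), if_neg (by lia), if_neg h]
      simp
  rw [setIntegral_congr_fun measurableSet_Ioi inner, integral_const_mul,
    integral_complex_ofReal]

end
end

section
/- Let m > 0, N ∈ ℤ, let F : (0,∞) → ℝ be continuously differentiable, let f : (0,∞) → ℂ be smooth and compactly supported in (0,∞), let ℓ ∈ ℤ, t ∈ {1,−1}, and let u_t ∈ ℂ² be a unit vector with τ₃ u_t = t u_t. Define Ψ(r,φ) := (1/(2√π)) ( f(r) e^{i ℓ φ} (e₁ ⊗ u_t) + f(r) e^{i (ℓ+1) φ} (e₂ ⊗ u_t) ) ∈ ℂ⁴, where e₁ = (1,0), e₂ = (0,1) ∈ ℂ², and define (L̃Ψ)(r,φ) := −(∂²Ψ/∂r² + (1/r) ∂Ψ/∂r + (1/r²) ∂²Ψ/∂φ²)(r,φ) + Ṽ(r,φ) Ψ(r,φ). Then ∫₀^∞ ∫₀^{2π} ⟨ Ψ(r,φ), (L̃Ψ)(r,φ) ⟩_{ℂ⁴} dφ · r dr = ⟨ f, R(ℓ,t) f ⟩₂, where (R(ℓ,t) f)(r) := −(1/2)(Δ_ℓ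 f)(r) − (1/2)(Δ_{ℓ+1} f)(r) + m t F'(r) sin(F(r)) f(r). -/
open MeasureTheory Matrix

noncomputable section

/-- The radial operator `Δ_ℓ`: `(Δ_ℓ f)(r) = f''(r) + f'(r)/r − (ℓ²/r²) f(r)`. -/
def Δl (ℓ : ℤ) (f : ℝ → ℂ) (r : ℝ) : ℂ :=
  deriv (deriv f) r + deriv f r / (r : ℂ) - ((ℓ : ℂ) ^ 2 / (r : ℂ) ^ 2) * f r

/-- `⟨u, v⟩₂ = ∫₀^∞ conj(u(r)) v(r) r dr`. -/
def ip2 (u v : ℝ → ℂ) : ℂ :=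
  ∫ r in Set.Ioi (0 : ℝ), (starRingEnd ℂ) (u r) * v r * (r : ℂ)

theorem hasDerivAt_exp_I_mul_int (k : ℤ) (φ : ℝ) :
    HasDerivAt (fun x : ℝ => Complex.exp (Complex.I * k * x))
      (Complex.I * k * Complex.exp (Complex.I * k * φ)) φ := by
  have h : HasDerivAt (fun x : ℝ => Complex.I * k * (x : ℂ)) (Complex.I * k * 1) φ :=
    (Complex.ofRealCLM.hasDerivAt (x := φ)).const_mul (Complex.I * (k : ℂ))
  simpa [mul_comm] using h.cexp

theorem deriv_deriv_exp_combination {ι : Type*} [Fintype ι] (k l : ℤ) (v w : ι → ℂ) (φ : ℝ) :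
    deriv (fun x : ℝ => deriv (fun y : ℝ =>
        Complex.exp (Complex.I * k * y) • v + Complex.exp (Complex.I * l * y) • w) x) φ
      = -((k : ℂ) ^ 2 * Complex.exp (Complex.I * k * φ)) • v
        - ((l : ℂ) ^ 2 * Complex.exp (Complex.I * l * φ)) • w := by
  have h : (fun x : ℝ => deriv (fun y : ℝ =>
        Complex.exp (Complex.I * k * y) • v + Complex.exp (Complex.I * l * y) • w) x)
      = fun x : ℝ => (Complex.I * k * Complex.exp (Complex.I * k * x)) • v
        + (Complex.I * l * Complex.exp (Complex.I * l * x)) • w := by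
    funext x
    exact (((hasDerivAt_exp_I_mul_int k x).smul_const v).add
      ((hasDerivAt_exp_I_mul_int l x).smul_const w)).deriv
  rw [h, sub_eq_add_neg, ← neg_smul]
  refine ((((hasDerivAt_exp_I_mul_int k φ).const_mul _).smul_const v).add
    (((hasDerivAt_exp_I_mul_int l φ).const_mul _).smul_const w)).deriv.trans ?_
  congr 2
  · linear_combination ((k : ℂ) ^ 2 * Complex.exp (Complex.I * k * φ)) * Complex.I_sq
  · linear_combination ((l : ℂ) ^ 2 * Complex.exp (Complex.I * l * φ)) * Complex.I_sq

theorem deriv_deriv_smul_const {E : Type*} [NormedAddCommGroup E] [NormedSpace ℂ E]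
    {f : ℝ → ℂ} (hf : ContDiff ℝ 2 f) (v : E) (r : ℝ) :
    deriv (fun s => deriv (fun x => f x • v) s) r = deriv (deriv f) r • v := by
  have h1 : Differentiable ℝ f := hf.differentiable (by norm_num)
  have h2 : Differentiable ℝ (deriv f) :=
    (contDiff_succ_iff_deriv (n := 1)).1 hf |>.2.2.differentiable (by norm_num)
  have h : (fun s => deriv (fun x => f x • v) s) = fun s => deriv f s • v := by
    funext s
    exact ((h1 s).hasDerivAt.smul_const v).deriv
  rw [h]
  exact ((h2 r).hasDerivAt.smul_const v).deriv

/-- The diagonal entries of `W̃` only involve the third component of the hedgehog. -/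
theorem Wt_hedgehog_diag (m : ℝ) {F : ℝ → ℝ} {ntilde : Fin 3 → ℝ → ℝ → ℝ}
    (hn3 : ∀ r φ, ntilde 2 r φ = Real.cos (F r)) {r : ℝ} (hF : DifferentiableAt ℝ F r) (φ : ℝ)
    (i : Fin 2) :
    Wt m ntilde r φ i i
      = m * Complex.exp (Complex.I * φ) * (deriv F r * Real.sin (F r)) * τ3 i i := by
  have hr : deriv (fun s => ntilde 2 s φ) r = -Real.sin (F r) * deriv F r := by
    simp only [hn3]
    exact hF.hasDerivAt.cos.deriv
  have hφ : deriv (fun ϑ => ntilde 2 r ϑ) φ = 0 := by simp [hn3]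
  fin_cases i <;>
    simp [Wt, Fin.sum_univ_three, hr, hφ, τ, τ1, τ2, τ3] <;> exact Or.inl (by ring)

theorem eq_zero_or_eq_zero_of_τ3_mulVec {t : ℝ} (ht : t = 1 ∨ t = -1) {u : Fin 2 → ℂ}
    (hut : τ3 *ᵥ u = (t : ℂ) • u) : t = 1 ∧ u 1 = 0 ∨ t = -1 ∧ u 0 = 0 := by
  have h0 := congrFun hut 0
  have h1 := congrFun hut 1
  rcases ht with rfl | rfl
  · left
    simp [τ3, mulVec, dotProduct] at h1
    exact ⟨rfl, by linear_combination (-1 / 2) * h1⟩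
  · right
    simp [τ3, mulVec, dotProduct] at h0
    exact ⟨rfl, by linear_combination (1 / 2) * h0⟩

/-- For `Ψ(r,φ) = (1/(2√π))( f(r) e^{iℓφ} (e₁ ⊗ u_t) + f(r) e^{i(ℓ+1)φ} (e₂ ⊗ u_t) )`
and `L̃Ψ = −(∂²_r + (1/r)∂_r + (1/r²)∂²_φ)Ψ + Ṽ Ψ`,
`∫₀^∞ ∫₀^{2π} ⟨Ψ, L̃Ψ⟩ dφ · r dr = ⟨f, R(ℓ,t) f⟩₂`, where
`R(ℓ,t) f = −(1/2)Δ_ℓ f − (1/2)Δ_{ℓ+1} f + m t F' sin(F) f`. -/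
theorem stmt_8 (m : ℝ) (hm : 0 < m) (N : ℤ)
    (F : ℝ → ℝ) (hF : ContDiffOn ℝ 1 F (Set.Ioi 0))
    (f : ℝ → ℂ) (hf : ContDiff ℝ (⊤ : ℕ∞) f) (hfc : HasCompactSupport f)
    (hfsupp : tsupport f ⊆ Set.Ioi 0)
    (ℓ : ℤ) (t : ℝ) (ht : t = 1 ∨ t = -1)
    (u : Fin 2 → ℂ) (hu : ‖u 0‖ ^ 2 + ‖u 1‖ ^ 2 = 1)
    (hut : τ3 *ᵥ u = (t : ℂ) • u)
    (ntilde : Fin 3 → ℝ → ℝ → ℝ)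
    (hn1 : ∀ r φ, ntilde 0 r φ = Real.sin (F r) * Real.cos (N * φ))
    (hn2 : ∀ r φ, ntilde 1 r φ = Real.sin (F r) * Real.sin (N * φ))
    (hn3 : ∀ r φ, ntilde 2 r φ = Real.cos (F r))
    (Ψ : ℝ → ℝ → (Fin 2 × Fin 2) → ℂ)
    (hΨ : ∀ r φ p, Ψ r φ p =
      (1 / (2 * Real.sqrt Real.pi) : ℂ) *
        (f r * Complex.exp (Complex.I * ℓ * φ) * (if p.1 = 0 then u p.2 else 0)
          + f r * Complex.exp (Complex.I * (ℓ + 1 : ℤ) * φ) * (if p.1 = 1 then u p.2 else 0))) :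
    (∫ r in Set.Ioi (0 : ℝ),
        (∫ φ in (0 : ℝ)..(2 * Real.pi),
          ∑ p : Fin 2 × Fin 2,
            (starRingEnd ℂ) (Ψ r φ p) *
              ((-(deriv (fun s => deriv (fun s' => Ψ s' φ) s) r
                   + (1 / (r : ℂ)) • deriv (fun s => Ψ s φ) r
                   + (1 / (r : ℂ) ^ 2) • deriv (fun ϑ => deriv (fun ϑ' => Ψ r ϑ') ϑ) φ)
                + Vt m ntilde r φ *ᵥ Ψ r φ) p))
          * (r : ℂ))
      = ip2 f (fun r =>
          -(1 / 2) * Δl ℓ f r - (1 / 2) * Δl (ℓ + 1) f r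
            + ((m * t : ℝ) : ℂ) * ((deriv F r : ℝ) : ℂ)
                * ((Real.sin (F r) : ℝ) : ℂ) * f r) := by
  have hF' : ∀ r ∈ Set.Ioi (0 : ℝ), DifferentiableAt ℝ F r := fun r hr =>
    (hF.differentiableOn (by norm_num)).differentiableAt (Ioi_mem_nhds hr)
  set K : ℂ := 1 / (2 * Real.sqrt Real.pi) with hK
  have hKK : 4 * Real.pi * (K * K) = 1 := by
    have h : ((Real.sqrt Real.pi : ℝ) : ℂ) * (Real.sqrt Real.pi : ℝ) = Real.pi := by
      rw [← Complex.ofReal_mul, Real.mul_self_sqrt Real.pi_pos.le]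
    have h0 : ((Real.sqrt Real.pi : ℝ) : ℂ) ≠ 0 :=
      Complex.ofReal_ne_zero.2 (Real.sqrt_ne_zero'.2 Real.pi_pos)
    rw [hK, ← h]
    field_simp
    norm_num
  have hKconj : (starRingEnd ℂ) K = K := by
    rw [hK, map_div₀, map_mul, map_one, map_ofNat, Complex.conj_ofReal]
  set v : Fin 2 × Fin 2 → ℂ := fun p => if p.1 = 0 then u p.2 else 0 with hv
  set w : Fin 2 × Fin 2 → ℂ := fun p => if p.1 = 1 then u p.2 else 0 with hw
  have hΨ' : ∀ r φ, Ψ r φ = f r • K • (Complex.exp (Complex.I * ℓ * φ) • v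
      + Complex.exp (Complex.I * (ℓ + 1 : ℤ) * φ) • w) := by
    intro r φ
    funext p
    simp only [hΨ, Pi.smul_apply, Pi.add_apply, smul_eq_mul, hv, hw]
    ring
  have hf2 : ContDiff ℝ 2 f := contDiff_infty.1 hf 2
  unfold ip2
  refine setIntegral_congr_fun measurableSet_Ioi fun r hr => ?_
  beta_reduce
  congr 1
  set R : ℂ := -(1 / 2) * Δl ℓ f r - (1 / 2) * Δl (ℓ + 1) f r
    + ((m * t : ℝ) : ℂ) * ((deriv F r : ℝ) : ℂ) * ((Real.sin (F r) : ℝ) : ℂ) * f r with hR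
  rw [intervalIntegral.integral_congr (g := fun _ => 2 * (K * K) * ((starRingEnd ℂ) (f r) * R))]
  · rw [intervalIntegral.integral_const, sub_zero, Complex.real_smul]
    push_cast
    linear_combination (starRingEnd ℂ (f r) * R) * hKK
  intro φ _
  beta_reduce
  have hrad : deriv (fun s => Ψ s φ) r = deriv f r • K • (Complex.exp (Complex.I * ℓ * φ) • v
      + Complex.exp (Complex.I * (ℓ + 1 : ℤ) * φ) • w) := by
    simp only [hΨ']
    exact ((hf2.differentiable (by norm_num) r).hasDerivAt.smul_const _).deriv
  have hrad2 : deriv (fun s => deriv (fun s' => Ψ s' φ) s) r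
      = deriv (deriv f) r • K • (Complex.exp (Complex.I * ℓ * φ) • v
      + Complex.exp (Complex.I * (ℓ + 1 : ℤ) * φ) • w) := by
    simp only [hΨ']
    exact deriv_deriv_smul_const hf2 _ r
  have hang : deriv (fun ϑ => deriv (fun ϑ' => Ψ r ϑ') ϑ) φ
      = f r • K • (-((ℓ : ℂ) ^ 2 * Complex.exp (Complex.I * ℓ * φ)) • v
        - (((ℓ + 1 : ℤ) : ℂ) ^ 2 * Complex.exp (Complex.I * (ℓ + 1 : ℤ) * φ)) • w) := by
    rw [← deriv_deriv_exp_combination]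
    simp only [hΨ', deriv_fun_const_smul_field]
  rw [hrad, hrad2, hang, hΨ']
  have he : Complex.exp (Complex.I * (ℓ + 1 : ℤ) * φ)
      = Complex.exp (Complex.I * ℓ * φ) * Complex.exp (Complex.I * φ) := by
    rw [← Complex.exp_add]
    push_cast
    ring_nf
  have hconj : ∀ k : ℤ, (starRingEnd ℂ) (Complex.exp (Complex.I * k * φ))
      * Complex.exp (Complex.I * k * φ) = 1 := by
    intro k
    rw [← Complex.exp_conj, ← Complex.exp_add]
    simp
  have hA := hconj ℓ
  have hB := hconj 1
  rw [Int.cast_one, mul_one] at hB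
  have hW := Wt_hedgehog_diag m hn3 (hF' r hr) φ
  rw [he]
  generalize Complex.exp (Complex.I * ℓ * φ) = A at hA ⊢
  generalize Complex.exp (Complex.I * φ) = B at hB hW ⊢
  rcases eq_zero_or_eq_zero_of_τ3_mulVec ht hut with ⟨rfl, hu0⟩ | ⟨rfl, hu0⟩
  · have hun : (starRingEnd ℂ) (u 0) * u 0 = 1 := by
      rw [Complex.conj_mul']
      exact_mod_cast (by simpa [hu0] using hu : ‖u 0‖ ^ 2 = 1)
    have h1 : (starRingEnd ℂ) A * A * ((starRingEnd ℂ) (u 0) * u 0) = 1 := by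
      rw [hA, hun, one_mul]
    have h2 : (starRingEnd ℂ) A * A * ((starRingEnd ℂ) B * B)
        * ((starRingEnd ℂ) (u 0) * u 0) = 1 := by
      rw [hA, hB, hun, one_mul, one_mul]
    simp [Fintype.sum_prod_type, Vt, mulVec, dotProduct, hv, hw, hu0, hW 0, τ3,
      hKconj, hR, Δl, -Complex.ofReal_sin]
    linear_combination ((starRingEnd ℂ) (f r) * K ^ 2
        * (ℓ ^ 2 / r ^ 2 * f r - deriv f r / r - deriv (deriv f) r)) * h1
      + ((starRingEnd ℂ) (f r) * K ^ 2
        * ((ℓ + 1) ^ 2 / r ^ 2 * f r - deriv f r / r - deriv (deriv f) r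
          + 2 * (m * (deriv F r : ℝ) * Real.sin (F r) * f r))) * h2
  · have hun : (starRingEnd ℂ) (u 1) * u 1 = 1 := by
      rw [Complex.conj_mul']
      exact_mod_cast (by simpa [hu0] using hu : ‖u 1‖ ^ 2 = 1)
    have h1 : (starRingEnd ℂ) A * A * ((starRingEnd ℂ) (u 1) * u 1) = 1 := by
      rw [hA, hun, one_mul]
    have h2 : (starRingEnd ℂ) A * A * ((starRingEnd ℂ) B * B)
        * ((starRingEnd ℂ) (u 1) * u 1) = 1 := by
      rw [hA, hB, hun, one_mul, one_mul]
    simp [Fintype.sum_prod_type, Vt, mulVec, dotProduct, hv, hw, hu0, hW 1, τ3,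
      hKconj, hR, Δl, -Complex.ofReal_sin]
    linear_combination ((starRingEnd ℂ) (f r) * K ^ 2
        * (ℓ ^ 2 / r ^ 2 * f r - deriv f r / r - deriv (deriv f) r)) * h1
      + ((starRingEnd ℂ) (f r) * K ^ 2
        * ((ℓ + 1) ^ 2 / r ^ 2 * f r - deriv f r / r - deriv (deriv f) r
          - 2 * (m * (deriv F r : ℝ) * Real.sin (F r) * f r))) * h2

end
end
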